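/- arXiv:1208.1350 — 3 statements merged into one kernel-verified Lean document; each statement's English description precedes it below -/
import Mathlib

section
/- (Craig's formula) For every real w ≥ 0, the Gaussian Q-function satisfies Q(√w) = (1/π) ∫_0^{π/2} exp(−w/(2 sin²θ)) dθ. -/
open MeasureTheory Real

/-- The Gaussian Q-function: `Q(x) = ∫_x^∞ (1/√(2π)) e^(−t²/2) dt`. -/
noncomputable def gaussQ (x : ℝ) : ℝ :=
  ∫ t in Set.Ioi x, (1 / Real.sqrt (2 * π)) * Real.exp (-t ^ 2 / 2)

theorem integrableOn_comp_polarCoord_symm {f : ℝ × ℝ → ℝ} (hf : Integrable f) :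
    IntegrableOn (fun p ↦ p.1 * f (polarCoord.symm p)) polarCoord.target := by
  have h := (integrableOn_image_iff_integrableOn_abs_det_fderiv_smul volume
    polarCoord.open_target.measurableSet
    (fun p _ ↦ (hasFDerivAt_polarCoord_symm p).hasFDerivWithinAt) polarCoord.symm.injOn f).1
    hf.integrableOn
  refine h.congr_fun (fun p hp ↦ ?_) polarCoord.open_target.measurableSet
  have hp' : 0 < p.1 := hp.1
  simp [det_fderivPolarCoordSymm, abs_of_pos hp']

theorem integral_Ioi_mul_exp_neg_half_sq {a : ℝ} (ha : 0 ≤ a) :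
    ∫ r in Set.Ioi a, r * exp (-(1 / 2) * r ^ 2) = exp (-(1 / 2) * a ^ 2) := by
  have h := integral_Ioi_of_hasDerivAt_of_nonneg' (a := a) (l := 0)
    (g := fun r ↦ -exp (-(1 / 2) * r ^ 2)) (g' := fun r ↦ r * exp (-(1 / 2) * r ^ 2))
    (fun r _ ↦ ?_) (fun r hr ↦ mul_nonneg (ha.trans hr.le) (exp_pos _).le) ?_
  · simpa using h
  · refine ((hasDerivAt_pow 2 r).const_mul (-(1 / 2) : ℝ)).exp.fun_neg.congr_deriv ?_
    push_cast
    ring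
  · rw [← neg_zero]
    refine (tendsto_exp_atBot.comp ?_).neg
    exact (Filter.tendsto_pow_atTop two_ne_zero).const_mul_atTop_of_neg (by norm_num)

theorem integral_Ioi_indicator_quadrant_polar {x θ : ℝ} (hx : 0 ≤ x) (hθ : θ ∈ Set.Ioo (-π) π) :
    ∫ r in Set.Ioi (0 : ℝ), r * (Set.Ioi 0 ×ˢ Set.Ioi x).indicator
        (fun p : ℝ × ℝ ↦ exp (-(1 / 2) * p.1 ^ 2) * exp (-(1 / 2) * p.2 ^ 2))
        (r * cos θ, r * sin θ) =
      (Set.Ioo 0 (π / 2)).indicator (fun θ ↦ exp (-x ^ 2 / (2 * sin θ ^ 2))) θ := by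
  by_cases h : θ ∈ Set.Ioo 0 (π / 2)
  · have hs : 0 < sin θ := sin_pos_of_pos_of_lt_pi h.1 hθ.2
    have hc : 0 < cos θ := cos_pos_of_mem_Ioo ⟨by linarith [h.1, pi_pos], h.2⟩
    have hxs : 0 ≤ x / sin θ := div_nonneg hx hs.le
    rw [Set.indicator_of_mem h]
    calc
      _ = ∫ r in Set.Ioi (0 : ℝ),
          (Set.Ioi (x / sin θ)).indicator (fun r ↦ r * exp (-(1 / 2) * r ^ 2)) r := by
        refine setIntegral_congr_fun measurableSet_Ioi fun r (hr : 0 < r) ↦ ?_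
        simp only [Set.indicator_apply, Set.mem_prod, Set.mem_Ioi, mul_pos hr hc, true_and,
          div_lt_iff₀ hs]
        split_ifs
        · rw [← exp_add]
          congr 2
          linear_combination (-(1 / 2) * r ^ 2) * (sin_sq_add_cos_sq θ)
        · simp
      _ = exp (-x ^ 2 / (2 * sin θ ^ 2)) := by
        rw [setIntegral_indicator measurableSet_Ioi, Set.Ioi_inter_Ioi, max_eq_right hxs,
          integral_Ioi_mul_exp_neg_half_sq hxs]
        congr 1
        field_simp
  · rw [Set.indicator_of_notMem h]
    refine setIntegral_eq_zero_of_forall_eq_zero fun r (hr : 0 < r) ↦ ?_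
    rw [Set.indicator_of_notMem, mul_zero]
    rintro ⟨h1, h2⟩
    have hc : 0 < cos θ := pos_of_mul_pos_right h1 hr.le
    have hs : 0 < sin θ := pos_of_mul_pos_right (hx.trans_lt h2) hr.le
    refine h ⟨?_, ?_⟩
    · by_contra! h0
      exact hs.not_ge (sin_nonpos_of_nonpos_of_neg_pi_le h0 hθ.1.le)
    · by_contra! h0
      exact hc.not_ge (cos_nonpos_of_pi_div_two_le_of_le h0 (by linarith [hθ.2, pi_pos]))

theorem integral_exp_neg_sq_div_sin_sq {x : ℝ} (hx : 0 ≤ x) :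
    ∫ θ in (0 : ℝ)..(π / 2), exp (-x ^ 2 / (2 * sin θ ^ 2)) =
      √(2 * π) / 2 * ∫ t in Set.Ioi x, exp (-(1 / 2) * t ^ 2) := by
  set f : ℝ × ℝ → ℝ := (Set.Ioi 0 ×ˢ Set.Ioi x).indicator
    (fun p : ℝ × ℝ ↦ exp (-(1 / 2) * p.1 ^ 2) * exp (-(1 / 2) * p.2 ^ 2)) with hf
  have hg : Integrable fun t : ℝ ↦ exp (-(1 / 2) * t ^ 2) :=
    integrable_exp_neg_mul_sq (by norm_num)
  have hfi : Integrable f :=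
    (hg.mul_prod hg).indicator (measurableSet_Ioi.prod measurableSet_Ioi)
  have hpi : Set.Ioo (-π) π ∩ Set.Ioo 0 (π / 2) = Set.Ioo 0 (π / 2) :=
    Set.inter_eq_right.2 (Set.Ioo_subset_Ioo (by linarith [pi_pos]) (by linarith [pi_pos]))
  have hpol : IntegrableOn (fun p ↦ p.1 * f (polarCoord.symm p))
      (Set.Ioi (0 : ℝ) ×ˢ Set.Ioo (-π) π) := integrableOn_comp_polarCoord_symm hfi
  calc
    _ = ∫ θ in Set.Ioo (-π) π,
        (Set.Ioo 0 (π / 2)).indicator (fun θ ↦ exp (-x ^ 2 / (2 * sin θ ^ 2))) θ := by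
      rw [setIntegral_indicator measurableSet_Ioo, hpi,
        intervalIntegral.integral_of_le (by positivity), integral_Ioc_eq_integral_Ioo]
    _ = ∫ θ in Set.Ioo (-π) π, ∫ r in Set.Ioi (0 : ℝ), r * f (r * cos θ, r * sin θ) :=
      setIntegral_congr_fun measurableSet_Ioo fun θ hθ ↦
        (integral_Ioi_indicator_quadrant_polar hx hθ).symm
    _ = ∫ p in polarCoord.target, p.1 • f (polarCoord.symm p) := by
      symm
      change ∫ p in Set.Ioi (0 : ℝ) ×ˢ Set.Ioo (-π) π, p.1 * f (polarCoord.symm p) = _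
      rw [Measure.volume_eq_prod, ← setIntegral_prod_swap]
      exact setIntegral_prod _ hpol.swap
    _ = ∫ p, f p := integral_comp_polarCoord_symm f
    _ = (∫ t in Set.Ioi (0 : ℝ), exp (-(1 / 2) * t ^ 2)) *
        ∫ t in Set.Ioi x, exp (-(1 / 2) * t ^ 2) := by
      rw [hf, integral_indicator (measurableSet_Ioi.prod measurableSet_Ioi),
        Measure.volume_eq_prod]
      exact setIntegral_prod_mul (L := ℝ) (fun t ↦ exp (-(1 / 2) * t ^ 2))
        (fun t ↦ exp (-(1 / 2) * t ^ 2)) _ _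
    _ = _ := by
      rw [integral_gaussian_Ioi]
      congr 3
      ring

/-- Craig's formula: `Q(√w) = (1/π) ∫_0^{π/2} exp(−w/(2 sin²θ)) dθ` for every `w ≥ 0`. -/
theorem craig_formula (w : ℝ) (hw : 0 ≤ w) :
    gaussQ (Real.sqrt w) =
      (1 / π) * ∫ θ in (0 : ℝ)..(π / 2), Real.exp (-w / (2 * Real.sin θ ^ 2)) := by
  have h := integral_exp_neg_sq_div_sin_sq (sqrt_nonneg w)
  rw [sq_sqrt hw] at h
  have hexp : ∀ t : ℝ, -t ^ 2 / 2 = -(1 / 2) * t ^ 2 := fun t ↦ by ring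
  simp only [gaussQ, hexp]
  rw [h, integral_const_mul, ← mul_assoc]
  congr 1
  have hsq : √(2 * π) ^ 2 = 2 * π := sq_sqrt (by positivity)
  have hpos : 0 < √(2 * π) := by positivity
  field_simp
  linarith
end

section
/- For every real x ≥ 0, the complementary error function satisfies erfc(x) = (2/π) ∫_0^{π/2} exp(−x²/sin²θ) dθ. -/
open MeasureTheory Real

/-- The complementary error function: `erfc(x) = (2/√π) ∫_x^∞ e^(−t²) dt`. -/
noncomputable def erfc (x : ℝ) : ℝ :=
  (2 / Real.sqrt π) * ∫ t in Set.Ioi x, Real.exp (-t ^ 2)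

theorem integral_Ioi_mul_exp_neg_sq {a : ℝ} (ha : 0 ≤ a) :
    ∫ r in Set.Ioi a, r * Real.exp (-r ^ 2) = Real.exp (-a ^ 2) / 2 := by
  have hderiv : ∀ r ∈ Set.Ici a,
      HasDerivAt (fun r : ℝ => -(Real.exp (-r ^ 2) / 2)) (r * Real.exp (-r ^ 2)) r := by
    intro r _
    refine (((hasDerivAt_pow 2 r).neg.exp).div_const 2).neg.congr_deriv ?_
    simp
    ring
  have hlim : Filter.Tendsto (fun r : ℝ => -(Real.exp (-r ^ 2) / 2)) Filter.atTop (nhds 0) := by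
    have h : Filter.Tendsto (fun r : ℝ => Real.exp (-r ^ 2)) Filter.atTop (nhds 0) :=
      Real.tendsto_exp_neg_atTop_nhds_zero.comp (Filter.tendsto_pow_atTop two_ne_zero)
    simpa using (h.div_const 2).neg
  rw [integral_Ioi_of_hasDerivAt_of_nonneg' hderiv
    (fun r hr => mul_nonneg (ha.trans (le_of_lt hr)) (Real.exp_pos _).le) hlim]
  ring

theorem integrableOn_Ioi_mul_exp_neg_sq :
    IntegrableOn (fun r : ℝ => r * Real.exp (-r ^ 2)) (Set.Ioi 0) := by
  simpa using (integrable_mul_exp_neg_mul_sq one_pos).integrableOn (s := Set.Ioi (0 : ℝ))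

/-- The radial integral of the Gaussian over the quadrant `{(s, t) | 0 < s, x < t}` along the ray
of angle `θ`. -/
theorem integral_radial_quadrant {x θ : ℝ} (hx : 0 ≤ x) (hθ : θ ∈ Set.Ioo (-π) π) :
    ∫ r in Set.Ioi (0 : ℝ), {p : ℝ × ℝ | 0 < p.1 * Real.cos p.2 ∧ x < p.1 * Real.sin p.2}.indicator
        (fun p => p.1 * Real.exp (-p.1 ^ 2)) (r, θ) =
      (Set.Ioo 0 (π / 2)).indicator (fun θ => Real.exp (-x ^ 2 / Real.sin θ ^ 2) / 2) θ := by
  by_cases h : θ ∈ Set.Ioo 0 (π / 2)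
  · have hs : 0 < Real.sin θ := Real.sin_pos_of_pos_of_lt_pi h.1 hθ.2
    have hc : 0 < Real.cos θ := Real.cos_pos_of_mem_Ioo ⟨by linarith [h.1, pi_pos], h.2⟩
    have hxs : 0 ≤ x / Real.sin θ := by positivity
    rw [Set.indicator_of_mem h]
    calc _ = ∫ r in Set.Ioi (0 : ℝ),
          (Set.Ioi (x / Real.sin θ)).indicator (fun r => r * Real.exp (-r ^ 2)) r := by
          refine setIntegral_congr_fun measurableSet_Ioi fun r hr => ?_
          have hr : 0 < r := hr
          simp [Set.indicator_apply, div_lt_iff₀ hs, hr, hc]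
      _ = ∫ r in Set.Ioi (x / Real.sin θ), r * Real.exp (-r ^ 2) := by
          rw [setIntegral_indicator measurableSet_Ioi,
            Set.inter_eq_right.mpr (Set.Ioi_subset_Ioi hxs)]
      _ = _ := by rw [integral_Ioi_mul_exp_neg_sq hxs, div_pow, neg_div]
  · rw [Set.indicator_of_notMem h]
    refine setIntegral_eq_zero_of_forall_eq_zero fun r hr => Set.indicator_of_notMem ?_ _
    rintro ⟨h1, h2⟩
    have hr : 0 < r := hr
    have hc : 0 < Real.cos θ := pos_of_mul_pos_right h1 hr.le
    have hs : 0 < Real.sin θ := pos_of_mul_pos_right (hx.trans_lt h2) hr.le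
    refine h ⟨?_, ?_⟩
    · by_contra! h0
      exact hs.not_ge (Real.sin_nonpos_of_nonpos_of_neg_pi_le h0 hθ.1.le)
    · by_contra! h0
      exact hc.not_ge (Real.cos_nonpos_of_pi_div_two_le_of_le h0 (by linarith [hθ.2, pi_pos]))

/-- The Gaussian integral over the quadrant `{(s, t) | 0 < s, x < t}` in polar coordinates. -/
theorem integral_Ioi_prod_Ioi_gaussian_polar {x : ℝ} (hx : 0 ≤ x) :
    (∫ s in Set.Ioi (0 : ℝ), Real.exp (-s ^ 2)) * ∫ t in Set.Ioi x, Real.exp (-t ^ 2) =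
      ∫ θ in (0 : ℝ)..(π / 2), Real.exp (-x ^ 2 / Real.sin θ ^ 2) / 2 := by
  set S : Set (ℝ × ℝ) := {p | 0 < p.1 * Real.cos p.2 ∧ x < p.1 * Real.sin p.2} with hS
  have hSm : MeasurableSet S := by
    rw [hS, Set.ofPred_and]
    exact (measurableSet_lt (by fun_prop) (by fun_prop)).inter
      (measurableSet_lt (by fun_prop) (by fun_prop))
  have hint : Integrable (S.indicator fun p : ℝ × ℝ => p.1 * Real.exp (-p.1 ^ 2))
      ((volume.restrict (Set.Ioi 0)).prod (volume.restrict (Set.Ioo (-π) π))) := by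
    refine Integrable.indicator ?_ hSm
    simpa using integrableOn_Ioi_mul_exp_neg_sq.integrable.mul_prod
      (integrable_const (1 : ℝ) (μ := volume.restrict (Set.Ioo (-π) π)))
  rw [← setIntegral_prod_mul, ← Measure.volume_eq_prod,
    ← integral_indicator (measurableSet_Ioi.prod measurableSet_Ioi),
    ← integral_comp_polarCoord_symm]
  calc _ = ∫ p in polarCoord.target, S.indicator (fun p => p.1 * Real.exp (-p.1 ^ 2)) p := by
        refine setIntegral_congr_fun polarCoord.open_target.measurableSet fun p _ => ?_
        have hexp : Real.exp (-(p.1 * Real.cos p.2) ^ 2) * Real.exp (-(p.1 * Real.sin p.2) ^ 2) =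
            Real.exp (-p.1 ^ 2) := by
          rw [← Real.exp_add]
          congr 1
          linear_combination -p.1 ^ 2 * Real.sin_sq_add_cos_sq p.2
        simp [Set.indicator_apply, hS, polarCoord_symm_apply, hexp]
    _ = ∫ θ in Set.Ioo (-π) π, ∫ r in Set.Ioi (0 : ℝ),
          S.indicator (fun p => p.1 * Real.exp (-p.1 ^ 2)) (r, θ) := by
        rw [polarCoord_target, Measure.volume_eq_prod, ← Measure.prod_restrict,
          integral_prod_symm _ hint]
    _ = ∫ θ in Set.Ioo (-π) π, (Set.Ioo 0 (π / 2)).indicator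
          (fun θ => Real.exp (-x ^ 2 / Real.sin θ ^ 2) / 2) θ :=
        setIntegral_congr_fun measurableSet_Ioo fun θ hθ => integral_radial_quadrant hx hθ
    _ = _ := by
        rw [setIntegral_indicator measurableSet_Ioo, Set.inter_eq_right.mpr
          (Set.Ioo_subset_Ioo (by linarith [pi_pos]) (by linarith [pi_pos])),
          intervalIntegral.integral_of_le (by positivity), integral_Ioc_eq_integral_Ioo]

/-- Craig-type formula for the complementary error function:
`erfc(x) = (2/π) ∫_0^{π/2} exp(−x²/sin²θ) dθ` for every `x ≥ 0`. -/
theorem craig_formula_erfc (x : ℝ) (hx : 0 ≤ x) :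
    erfc x = (2 / π) * ∫ θ in (0 : ℝ)..(π / 2), Real.exp (-x ^ 2 / Real.sin θ ^ 2) := by
  have hgauss : ∫ s in Set.Ioi (0 : ℝ), Real.exp (-s ^ 2) = √π / 2 := by
    simpa using integral_gaussian_Ioi 1
  have hpolar := integral_Ioi_prod_Ioi_gaussian_polar hx
  rw [hgauss, intervalIntegral.integral_div] at hpolar
  have hsqrt : √π ≠ 0 := (Real.sqrt_pos.mpr pi_pos).ne'
  have hsq : √π ^ 2 = π := Real.sq_sqrt pi_pos.le
  rw [erfc, show (∫ θ in (0 : ℝ)..(π / 2), Real.exp (-x ^ 2 / Real.sin θ ^ 2)) =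
    √π * ∫ t in Set.Ioi x, Real.exp (-t ^ 2) by linarith, ← mul_assoc]
  congr 1
  rw [div_mul_eq_mul_div, div_eq_div_iff hsqrt pi_ne_zero]
  linear_combination -2 * hsq
end

section
/- For every a > 0 and b > 0, (1/π) ∫_0^{π/2} (1 + b/(2 sin²θ))^{−a} dθ = (1/(2√(2π))) · (√b · Γ(a + 1/2)) / ((1 + b/2)^{a + 1/2} · Γ(a + 1)) · Σ_{n=0}^∞ [ (1)_n (a + 1/2)_n / (a + 1)_n ] · (2/(2 + b))^n / n!, where the series on the right converges. -/
open MeasureTheory Real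

/-- The rising factorial (Pochhammer symbol) `(q)_n = q (q+1) ⋯ (q+n−1)`, with `(q)_0 = 1`. -/
noncomputable def risingFactorial (q : ℝ) (n : ℕ) : ℝ :=
  ∏ i ∈ Finset.range n, (q + i)

theorem risingFactorial_mul_Gamma {q : ℝ} (hq : 0 < q) (n : ℕ) :
    risingFactorial q n * Real.Gamma q = Real.Gamma (q + n) := by
  induction n with
  | zero => simp [risingFactorial]
  | succ n ih =>
    have hn : q + n ≠ 0 := by positivity
    rw [risingFactorial, Finset.prod_range_succ, ← risingFactorial, Nat.cast_succ, ← add_assoc,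
      Real.Gamma_add_one hn, ← ih]
    ring

theorem risingFactorial_one (n : ℕ) : risingFactorial 1 n = (Nat.factorial n : ℝ) := by
  have h := risingFactorial_mul_Gamma one_pos n
  rwa [Real.Gamma_one, mul_one, add_comm, Real.Gamma_nat_eq_factorial] at h

theorem risingFactorial_eq_Gamma_div {q : ℝ} (hq : 0 < q) (n : ℕ) :
    risingFactorial q n = Real.Gamma (q + n) / Real.Gamma q :=
  eq_div_of_mul_eq (Real.Gamma_pos_of_pos hq).ne' (risingFactorial_mul_Gamma hq n)

theorem ofReal_rpow_mul_one_sub_rpow (p q : ℝ) {t : ℝ} (ht : t ∈ Set.uIcc (0 : ℝ) 1) :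
    (t : ℂ) ^ ((p : ℂ) - 1) * (1 - (t : ℂ)) ^ ((q : ℂ) - 1) =
      ((t ^ (p - 1) * (1 - t) ^ (q - 1) : ℝ) : ℂ) := by
  rw [Set.uIcc_of_le zero_le_one] at ht
  rw [Complex.ofReal_mul, Complex.ofReal_cpow ht.1, Complex.ofReal_cpow (sub_nonneg.2 ht.2)]
  push_cast
  rfl

theorem intervalIntegrable_rpow_mul_one_sub_rpow {p q : ℝ} (hp : 0 < p) (hq : 0 < q) :
    IntervalIntegrable (fun t : ℝ => t ^ (p - 1) * (1 - t) ^ (q - 1)) volume 0 1 := by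
  have h := Complex.betaIntegral_convergent (u := p) (v := q) (by simpa) (by simpa)
  have h' := h.congr (g := fun t : ℝ => ((t ^ (p - 1) * (1 - t) ^ (q - 1) : ℝ) : ℂ))
    fun t ht => ofReal_rpow_mul_one_sub_rpow p q (Set.uIoc_subset_uIcc ht)
  rw [intervalIntegrable_iff] at h' ⊢
  simpa [IntegrableOn] using h'.re

theorem integral_rpow_mul_one_sub_rpow {p q : ℝ} (hp : 0 < p) (hq : 0 < q) :
    ∫ t in (0 : ℝ)..1, t ^ (p - 1) * (1 - t) ^ (q - 1) =
      Real.Gamma p * Real.Gamma q / Real.Gamma (p + q) := by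
  have h := Complex.betaIntegral_eq_Gamma_mul_div (p : ℂ) (q : ℂ) (by simpa) (by simpa)
  rw [Complex.betaIntegral, intervalIntegral.integral_congr
    fun t ht => ofReal_rpow_mul_one_sub_rpow p q ht, intervalIntegral.integral_ofReal,
    ← Complex.ofReal_add, Complex.Gamma_ofReal, Complex.Gamma_ofReal, Complex.Gamma_ofReal] at h
  exact_mod_cast h

/-- Euler's integral for `₂F₁(1, p; p + q; x)`, expanded termwise. -/
theorem hasSum_integral_rpow_mul_one_sub_rpow_div {p q x : ℝ} (hp : 0 < p) (hq : 0 < q)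
    (hx₀ : 0 ≤ x) (hx₁ : x < 1) :
    HasSum (fun n : ℕ => x ^ n * (Real.Gamma (p + n) * Real.Gamma q / Real.Gamma (p + n + q)))
      (∫ t in (0 : ℝ)..1, t ^ (p - 1) * (1 - t) ^ (q - 1) / (1 - x * t)) := by
  have hβ := intervalIntegrable_rpow_mul_one_sub_rpow hp hq
  have key := intervalIntegral.hasSum_integral_of_dominated_convergence (μ := volume)
    (a := (0 : ℝ)) (b := 1)
    (F := fun (n : ℕ) (t : ℝ) => x ^ n * (t ^ (p + n - 1) * (1 - t) ^ (q - 1)))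
    (f := fun t => t ^ (p - 1) * (1 - t) ^ (q - 1) / (1 - x * t))
    (fun n t => x ^ n * (t ^ (p - 1) * (1 - t) ^ (q - 1)))
    (fun n => (by fun_prop : Measurable _).aestronglyMeasurable) ?_ ?_ ?_ ?_
  · refine key.congr_fun fun n => ?_
    rw [intervalIntegral.integral_const_mul, integral_rpow_mul_one_sub_rpow (by positivity) hq]
  · refine fun n => ae_of_all _ fun t ht => ?_
    rw [Set.uIoc_of_le zero_le_one] at ht
    have ht₁ : 0 ≤ 1 - t := sub_nonneg.2 ht.2
    have ht₀ := ht.1.le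
    rw [Real.norm_of_nonneg (by positivity)]
    gcongr ?_ * (?_ * ?_)
    exact Real.rpow_le_rpow_of_exponent_ge ht.1 ht.2 (by linarith [n.cast_nonneg (α := ℝ)])
  · exact ae_of_all _ fun t _ => (summable_geometric_of_lt_one hx₀ hx₁).mul_right _
  · simp_rw [tsum_mul_right]
    exact hβ.const_mul _
  · refine ae_of_all _ fun t ht => ?_
    rw [Set.uIoc_of_le zero_le_one] at ht
    have hxt : x * t < 1 := (mul_le_of_le_one_right hx₀ ht.2).trans_lt hx₁
    have h := (hasSum_geometric_of_lt_one (mul_nonneg hx₀ ht.1.le) hxt).mul_left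
      (t ^ (p - 1) * (1 - t) ^ (q - 1))
    rw [← div_eq_mul_inv] at h
    refine h.congr_fun fun n => ?_
    rw [add_sub_right_comm, Real.rpow_add_natCast ht.1.ne', mul_pow]
    ring

/-- The substitution `t = (1 + c) sin² θ / (sin² θ + c)`. -/
theorem integral_sin_sq_div_sin_sq_add_rpow (a : ℝ) {c : ℝ} (hc : 0 < c) :
    ∫ θ in (0 : ℝ)..(π / 2), ((1 + c) * Real.sin θ ^ 2 / (Real.sin θ ^ 2 + c)) ^ a =
      Real.sqrt (c / (1 + c)) / 2 * ∫ t in (0 : ℝ)..1,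
        t ^ (a + 1 / 2 - 1) * (1 - t) ^ ((1 / 2 : ℝ) - 1) / (1 - 1 / (1 + c) * t) := by
  set w : ℝ → ℝ := fun θ => (1 + c) * Real.sin θ ^ 2 / (Real.sin θ ^ 2 + c) with hw
  have hD : ∀ θ : ℝ, 0 < Real.sin θ ^ 2 + c := fun θ => by positivity
  have hderiv : ∀ θ : ℝ, HasDerivAt w
      ((1 + c) * c * (2 * Real.sin θ * Real.cos θ) / (Real.sin θ ^ 2 + c) ^ 2) θ := by
    intro θ
    have h := (Real.hasDerivAt_sin θ).pow 2
    refine ((h.const_mul (1 + c)).div (h.add_const c) (hD θ).ne').congr_deriv ?_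
    simp
    ring
  have hpi : min 0 (π / 2) = 0 ∧ max 0 (π / 2) = π / 2 :=
    ⟨min_eq_left (by positivity), max_eq_right (by positivity)⟩
  have hsin : ∀ θ ∈ Set.Ioo 0 (π / 2), 0 < Real.sin θ := fun θ hθ =>
    Real.sin_pos_of_pos_of_lt_pi hθ.1 (by linarith [hθ.2, Real.pi_pos])
  have hcos : ∀ θ ∈ Set.Ioo 0 (π / 2), 0 < Real.cos θ := fun θ hθ =>
    Real.cos_pos_of_mem_Ioo ⟨by linarith [hθ.1, Real.pi_pos], hθ.2⟩
  have hsub := intervalIntegral.integral_comp_mul_deriv_of_deriv_nonneg (a := 0) (b := π / 2)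
    (f := w)
    (g := fun t => t ^ (a + 1 / 2 - 1) * (1 - t) ^ ((1 / 2 : ℝ) - 1) / (1 - 1 / (1 + c) * t))
    (fun θ _ => (hderiv θ).continuousAt.continuousWithinAt) (fun θ _ => hderiv θ) (by
      rw [hpi.1, hpi.2]
      intro θ hθ
      have := hsin θ hθ
      have := hcos θ hθ
      positivity)
  have hw0 : w 0 = 0 := by simp [hw]
  have hw1 : w (π / 2) = 1 := by
    simp only [hw, Real.sin_pi_div_two, one_pow, mul_one]
    exact div_self (by positivity)
  rw [hw0, hw1] at hsub
  rw [← hsub, ← intervalIntegral.integral_const_mul]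
  refine intervalIntegral.integral_congr_Ioo_of_le (by positivity) fun θ hθ => ?_
  have hs := hsin θ hθ
  have hk := hcos θ hθ
  have hDθ := hD θ
  have hwpos : 0 < w θ := by simp only [hw]; positivity
  have h1w : 1 - w θ = c * Real.cos θ ^ 2 / (Real.sin θ ^ 2 + c) := by
    simp only [hw]
    rw [Real.cos_sq']
    field_simp
    ring
  have h1xw : 1 - 1 / (1 + c) * w θ = c / (Real.sin θ ^ 2 + c) := by
    simp only [hw]
    field_simp
    ring
  have hrw : w θ ^ (a + 1 / 2 - 1) = w θ ^ a * (Real.sqrt (w θ))⁻¹ := by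
    rw [Real.sqrt_eq_rpow, ← Real.rpow_neg hwpos.le, ← Real.rpow_add hwpos]
    norm_num [add_sub_assoc]
  have hr1 : (1 - w θ) ^ ((1 / 2 : ℝ) - 1) = (Real.sqrt (1 - w θ))⁻¹ := by
    rw [Real.sqrt_eq_rpow, ← Real.rpow_neg (by rw [h1w]; positivity)]
    norm_num
  have hsw : Real.sqrt (w θ) =
      Real.sqrt (1 + c) * Real.sin θ / Real.sqrt (Real.sin θ ^ 2 + c) := by
    simp only [hw]
    rw [Real.sqrt_div (by positivity), Real.sqrt_mul (by positivity), Real.sqrt_sq hs.le]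
  have hs1 : Real.sqrt (1 - w θ) =
      Real.sqrt c * Real.cos θ / Real.sqrt (Real.sin θ ^ 2 + c) := by
    rw [h1w, Real.sqrt_div (by positivity), Real.sqrt_mul hc.le, Real.sqrt_sq hk.le]
  simp only [Function.comp]
  change w θ ^ a = _
  rw [hrw, hr1, h1xw, hsw, hs1, Real.sqrt_div hc.le]
  have hD2 := Real.sq_sqrt hDθ.le
  have hc2 := Real.sq_sqrt (by positivity : 0 ≤ 1 + c)
  field_simp
  rw [hD2, hc2]

/-- Closed form of `(1/π) ∫_0^{π/2} (1 + b/(2 sin²θ))^(−a) dθ` in terms of the Gauss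
hypergeometric series `₂F₁(1, a + 1/2; a + 1; 2/(2 + b))`, together with the convergence
of that series. -/
theorem integral_one_add_div_sin_sq_rpow (a b : ℝ) (ha : 0 < a) (hb : 0 < b) :
    Summable (fun n : ℕ =>
      risingFactorial 1 n * risingFactorial (a + 1 / 2) n / risingFactorial (a + 1) n *
        (2 / (2 + b)) ^ n / (Nat.factorial n : ℝ)) ∧
    (1 / π) * (∫ θ in (0 : ℝ)..(π / 2), (1 + b / (2 * Real.sin θ ^ 2)) ^ (-a)) =
      (1 / (2 * Real.sqrt (2 * π))) *
        (Real.sqrt b * Real.Gamma (a + 1 / 2)) /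
          ((1 + b / 2) ^ (a + 1 / 2) * Real.Gamma (a + 1)) *
        ∑' n : ℕ,
          risingFactorial 1 n * risingFactorial (a + 1 / 2) n / risingFactorial (a + 1) n *
            (2 / (2 + b)) ^ n / (Nat.factorial n : ℝ) := by
  set c : ℝ := b / 2 with hcdef
  have hc : 0 < c := by positivity
  have hx : 2 / (2 + b) = 1 / (1 + c) := by
    rw [hcdef]
    field_simp
  have hcoef : ∀ n : ℕ,
      risingFactorial 1 n * risingFactorial (a + 1 / 2) n / risingFactorial (a + 1) n *
        (2 / (2 + b)) ^ n / (Nat.factorial n : ℝ) =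
      Real.Gamma (a + 1) / (Real.Gamma (a + 1 / 2) * Real.sqrt π) *
        ((1 / (1 + c)) ^ n * (Real.Gamma (a + 1 / 2 + n) * Real.Gamma (1 / 2) /
          Real.Gamma (a + 1 / 2 + n + 1 / 2))) := by
    intro n
    have h₁ := (Real.Gamma_pos_of_pos (by positivity : 0 < a + 1 / 2)).ne'
    have h₂ := (Real.Gamma_pos_of_pos (by positivity : 0 < a + 1)).ne'
    have h₃ := (Real.Gamma_pos_of_pos (by positivity : 0 < a + 1 + n)).ne'
    rw [hx, risingFactorial_one, risingFactorial_eq_Gamma_div (by positivity),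
      risingFactorial_eq_Gamma_div (by positivity), Real.Gamma_one_half_eq,
      show a + 1 / 2 + n + 1 / 2 = a + 1 + n by ring]
    field_simp
  have hsum := (hasSum_integral_rpow_mul_one_sub_rpow_div (p := a + 1 / 2) (q := 1 / 2)
    (x := 1 / (1 + c)) (by positivity) (by positivity) (by positivity)
    (by rw [div_lt_one (by positivity)]; linarith)).mul_left
      (Real.Gamma (a + 1) / (Real.Gamma (a + 1 / 2) * Real.sqrt π))
  simp_rw [← hcoef] at hsum
  refine ⟨hsum.summable, ?_⟩
  have hint : ∫ θ in (0 : ℝ)..(π / 2), (1 + b / (2 * Real.sin θ ^ 2)) ^ (-a) =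
      ((1 + c) ^ a)⁻¹ *
        ∫ θ in (0 : ℝ)..(π / 2), ((1 + c) * Real.sin θ ^ 2 / (Real.sin θ ^ 2 + c)) ^ a := by
    rw [← intervalIntegral.integral_const_mul]
    refine intervalIntegral.integral_congr_Ioo_of_le (by positivity) fun θ hθ => ?_
    have hs : 0 < Real.sin θ :=
      Real.sin_pos_of_pos_of_lt_pi hθ.1 (by linarith [hθ.2, Real.pi_pos])
    rw [Real.rpow_neg (by positivity), ← Real.inv_rpow (by positivity),
      ← Real.inv_rpow (by positivity), ← Real.mul_rpow (by positivity) (by positivity)]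
    congr 1
    rw [hcdef]
    field_simp
  rw [hsum.tsum_eq, hint, integral_sin_sq_div_sin_sq_add_rpow a hc]
  have h₁ := (Real.Gamma_pos_of_pos (by positivity : 0 < a + 1 / 2)).ne'
  have h₂ := (Real.Gamma_pos_of_pos (by positivity : 0 < a + 1)).ne'
  have hb2 : Real.sqrt b = Real.sqrt 2 * Real.sqrt c := by
    rw [← Real.sqrt_mul (by norm_num), hcdef]
    congr 1
    ring
  have hπ := Real.sq_sqrt Real.pi_pos.le
  rw [hb2, Real.sqrt_div hc.le, Real.sqrt_mul (by norm_num), Real.rpow_add (by positivity),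
    ← Real.sqrt_eq_rpow]
  generalize (∫ t in (0 : ℝ)..1, _ : ℝ) = J
  field_simp
  rw [hπ]
  ring
end
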